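/- Let r ≥ 2 and m ≥ r + 2, and let α₁, …, α_r, b_{r+2}, …, b_m be elements of a commutative ring. Then K(α₁,…,α_{r−1}, α_r − 1, 1, b_{r+2},…,b_m)·K(α₂,…,α_{r−1}, α_r − 1, 2) − K(α₁,…,α_{r−1}, α_r − 1, 2)·K(α₂,…,α_{r−1}, α_r − 1, 1, b_{r+2},…,b_m) = (−1)^{r+1}·K(b_{r+2} − 1, b_{r+3},…,b_m). -/

import Mathlib

/-- Auxiliary continuant, recursing on the *first* element of the (reversed) list. -/
def contAux {R : Type*} [CommRing R] : List R → R
  | [] => 1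
  | [x] => x
  | x :: y :: t => x * contAux (y :: t) + contAux t

/-- The continuant `K(x₁,…,xₙ)` with `K() = 1`, `K(x₁) = x₁`, and
`K(x₁,…,xₙ) = xₙ·K(x₁,…,xₙ₋₁) + K(x₁,…,xₙ₋₂)`. -/
def cont {R : Type*} [CommRing R] (l : List R) : R := contAux l.reverse

theorem contAux_append_pair {R : Type*} [CommRing R] (x y : R) :
    ∀ l : List R, contAux (l ++ [y, x]) = x * contAux (l ++ [y]) + contAux l
  | [] => by simp only [List.nil_append, contAux]; ring
  | [z] => by simp only [List.cons_append, List.nil_append, contAux]; ring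
  | z :: w :: t => by
    have h₁ := contAux_append_pair x y (w :: t)
    have h₂ := contAux_append_pair x y t
    simp only [List.cons_append, contAux] at h₁ h₂ ⊢
    rw [h₁, h₂]
    ring

theorem cont_nil {R : Type*} [CommRing R] : cont ([] : List R) = 1 := rfl

theorem cont_singleton {R : Type*} [CommRing R] (x : R) : cont [x] = x := rfl

/-- The continuant satisfies the same recursion at its first entry. -/
theorem cont_cons_cons {R : Type*} [CommRing R] (x y : R) (l : List R) :
    cont (x :: y :: l) = x * cont (y :: l) + cont l := by
  simpa [cont] using contAux_append_pair x y l.reverse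

theorem cont_sub_one_cons {R : Type*} [CommRing R] (x : R) (l : List R) :
    cont ((x - 1) :: l) = cont (x :: l) - cont l := by
  cases l with
  | nil => simp only [cont_nil, cont_singleton]
  | cons y l => simp only [cont_cons_cons]; ring

/-- The cross difference of continuants with a common prefix depends on that prefix only through
a sign. -/
theorem cont_cross_sub {R : Type*} [CommRing R] (x y : R) (X Y : List R) (a : R) (L : List R) :
    cont (a :: L ++ x :: X) * cont (L ++ y :: Y) - cont (a :: L ++ y :: Y) * cont (L ++ x :: X)
      = (-1) ^ L.length *
        (cont X * cont (y :: Y) - cont Y * cont (x :: X)) := by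
  induction L generalizing a with
  | nil =>
    simp only [List.cons_append, List.nil_append, cont_cons_cons, List.length_nil, pow_zero]
    ring
  | cons c L ih =>
    have h := ih c
    simp only [List.cons_append, cont_cons_cons a, List.length_cons, pow_succ] at h ⊢
    linear_combination -h

/-- for `r ≥ 2` and `m ≥ r + 2` (here `(α₁,…,α_r) = A ++ [ar]` with
`A = (α₁,…,α_{r−1})` nonempty, and `(b_{r+2},…,b_m) = b :: bs` nonempty):
`K(α₁,…,α_{r−1}, α_r−1, 1, b_{r+2},…,b_m)·K(α₂,…,α_{r−1}, α_r−1, 2)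
  − K(α₁,…,α_{r−1}, α_r−1, 2)·K(α₂,…,α_{r−1}, α_r−1, 1, b_{r+2},…,b_m)
  = (−1)^{r+1}·K(b_{r+2}−1, b_{r+3},…,b_m)`. -/
theorem cont_det_tail_block' {R : Type*} [CommRing R] (A : List R) (ar : R)
    (b : R) (bs : List R) (hA : 1 ≤ A.length) :
    cont (A ++ [ar - 1, 1] ++ (b :: bs)) * cont (A.tail ++ [ar - 1, 2])
      - cont (A ++ [ar - 1, 2]) * cont (A.tail ++ [ar - 1, 1] ++ (b :: bs))
      = (-1 : R) ^ (A.length + 1 + 1) * cont ((b - 1) :: bs) := by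
  obtain ⟨a, L, rfl⟩ := List.exists_cons_of_length_pos hA
  have h := cont_cross_sub (ar - 1) (ar - 1) (1 :: b :: bs) [2] a L
  simp only [List.append_assoc, List.cons_append, List.nil_append, List.tail_cons,
    List.length_cons, cont_sub_one_cons b] at h ⊢
  rw [h]
  simp only [cont_cons_cons, cont_singleton, cont_nil]
  ring
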